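/- Conservativeness of the CD under collision: if the true distance δ₀ < R, then for any α ∈ (0,1), P(1 - C(R | Y) > 1 - α) ≤ α, i.e., the distribution of 1 - C(R | Y) is stochastically smaller than uniform. -/

import Mathlib

open MeasureTheory ProbabilityTheory Real Filter Set

/-- Modified Bessel function of the first kind, order 0. -/
noncomputable def besselI0 (z : ℝ) : ℝ :=
  ∑' k : ℕ, (z / 2) ^ (2 * k) / ((Nat.factorial k : ℝ)) ^ 2

/-- Density of the non-central chi-squared distribution with 2 degrees of
freedom and noncentrality `ν`. -/
noncomputable def ncChi2Pdf (ν t : ℝ) : ℝ :=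
  (1 / 2) * Real.exp (-(t + ν) / 2) * besselI0 (Real.sqrt (ν * t))

/-- Cdf `Γ₂ x ν` of the non-central chi-squared distribution with 2 degrees
of freedom and noncentrality `ν`. -/
noncomputable def Gamma2 (x ν : ℝ) : ℝ := ∫ t in (0:ℝ)..x, ncChi2Pdf ν t


lemma aux_prod (k : ℕ) : (∏ i ∈ Finset.range k, (2 * (i : ℝ) + 1) / (2 * i + 2))
    = (Nat.factorial (2 * k) : ℝ) / (4 ^ k * (Nat.factorial k : ℝ) ^ 2) := by
  induction k with
  | zero => simp
  | succ k ih =>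
    rw [Finset.prod_range_succ, ih]
    have h1 : (Nat.factorial (2 * (k + 1)) : ℝ)
        = (2 * k + 2) * ((2 * k + 1) * Nat.factorial (2 * k)) := by
      rw [show 2 * (k + 1) = (2 * k + 1) + 1 by ring, Nat.factorial_succ, Nat.factorial_succ]
      push_cast; ring
    have h2 : (Nat.factorial (k + 1) : ℝ) = (k + 1) * Nat.factorial k := by
      rw [Nat.factorial_succ]; push_cast; ring
    rw [h1, h2]
    have h3 : (Nat.factorial k : ℝ) ≠ 0 := by positivity
    have h4 : (k : ℝ) + 1 ≠ 0 := by positivity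
    field_simp
    ring

lemma bessel_cosh (z : ℝ) : (∫ φ in (0:ℝ)..π, Real.cosh (z * Real.sin φ)) = π * besselI0 z := by
  have key : HasSum (fun n : ℕ => ∫ φ in (0:ℝ)..π, (z * Real.sin φ) ^ (2 * n) / (Nat.factorial (2 * n) : ℝ))
      (∫ φ in (0:ℝ)..π, Real.cosh (z * Real.sin φ)) := by
    refine intervalIntegral.hasSum_integral_of_dominated_convergence
      (fun n _ => z ^ (2 * n) / (Nat.factorial (2 * n) : ℝ)) (fun n => ?_) (fun n => ?_) ?_ ?_ ?_
    · exact (by fun_prop : Continuous fun φ => (z * Real.sin φ) ^ (2 * n) / (Nat.factorial (2 * n) : ℝ)).aestronglyMeasurable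
    · refine ae_of_all _ fun φ _ => ?_
      have h1 : (Real.sin φ) ^ (2 * n) ≤ 1 := by
        rw [pow_mul]
        exact pow_le_one₀ (sq_nonneg _) (Real.sin_sq_le_one φ)
      have h0 : 0 ≤ (Real.sin φ) ^ (2 * n) := by rw [pow_mul]; positivity
      have hz : 0 ≤ z ^ (2 * n) := by rw [pow_mul]; positivity
      rw [mul_pow, Real.norm_of_nonneg (by positivity)]
      gcongr
      nlinarith
    · exact ae_of_all _ fun φ _ => (Real.hasSum_cosh z).summable
    · exact intervalIntegrable_const
    · exact ae_of_all _ fun φ _ => Real.hasSum_cosh _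
  rw [← key.tsum_eq, besselI0, ← tsum_mul_left]
  congr 1
  ext n
  have h3 : (Nat.factorial n : ℝ) ≠ 0 := by positivity
  have h4 : (Nat.factorial (2 * n) : ℝ) ≠ 0 := by positivity
  simp_rw [mul_pow, mul_div_right_comm]
  rw [intervalIntegral.integral_const_mul, integral_sin_pow_even, aux_prod, div_pow]
  have : (2:ℝ) ^ (2 * n) = 4 ^ n := by rw [pow_mul]; norm_num
  rw [this]
  field_simp

lemma bessel_exp (z : ℝ) : (∫ φ in (-π)..π, Real.exp (z * Real.sin φ)) = 2 * π * besselI0 z := by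
  have hc : ∀ z : ℝ, Continuous fun φ => Real.exp (z * Real.sin φ) := fun z => by fun_prop
  rw [← intervalIntegral.integral_add_adjacent_intervals (b := 0)
    ((hc z).intervalIntegrable _ _) ((hc z).intervalIntegrable _ _)]
  have h : (∫ φ in (-π)..0, Real.exp (z * Real.sin φ))
      = ∫ φ in (0:ℝ)..π, Real.exp ((-z) * Real.sin φ) := by
    have := intervalIntegral.integral_comp_neg (a := 0) (b := π) (fun φ => Real.exp (z * Real.sin φ))
    simp only [neg_zero] at this
    rw [← this]
    congr 1; ext φ; rw [Real.sin_neg]; ring_nf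
  rw [h, ← intervalIntegral.integral_add ((hc _).intervalIntegrable _ _) ((hc z).intervalIntegrable _ _),
    mul_assoc, ← bessel_cosh, ← intervalIntegral.integral_const_mul]
  congr 1; ext φ; rw [Real.cosh_eq]; ring_nf

lemma bessel_ab (a b r : ℝ) :
    (∫ φ in (-π)..π, Real.exp (r * (a * Real.cos φ + b * Real.sin φ)))
      = 2 * π * besselI0 (r * Real.sqrt (a ^ 2 + b ^ 2)) := by
  set ρ := Real.sqrt (a ^ 2 + b ^ 2) with hρ
  obtain ⟨ψ, ha, hb⟩ : ∃ ψ : ℝ, a = ρ * Real.sin ψ ∧ b = ρ * Real.cos ψ := by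
    refine ⟨Complex.arg (⟨b, a⟩ : ℂ), ?_, ?_⟩
    · have := Complex.norm_mul_sin_arg (⟨b, a⟩ : ℂ)
      rw [Complex.norm_def, Complex.normSq_mk] at this
      rw [hρ, show a ^ 2 + b ^ 2 = b * b + a * a by ring, this]
    · have := Complex.norm_mul_cos_arg (⟨b, a⟩ : ℂ)
      rw [Complex.norm_def, Complex.normSq_mk] at this
      rw [hρ, show a ^ 2 + b ^ 2 = b * b + a * a by ring, this]
  have h1 : ∀ φ, Real.exp (r * (a * Real.cos φ + b * Real.sin φ))
      = (fun x => Real.exp (r * ρ * Real.sin x)) (φ + ψ) := by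
    intro φ
    simp only [Real.sin_add]
    conv_lhs => rw [ha, hb]
    ring_nf
  simp_rw [h1]
  rw [intervalIntegral.integral_comp_add_right (fun x => Real.exp (r * ρ * Real.sin x)), ← bessel_exp]
  have hp : Function.Periodic (fun x => Real.exp (r * ρ * Real.sin x)) (2 * π) := by
    intro x; simp
  have := hp.intervalIntegral_add_eq (-π + ψ) (-π)
  rw [show -π + ψ + 2 * π = π + ψ by ring, show -π + 2 * π = π by ring] at this
  exact this

lemma bessel_cont : Continuous besselI0 := by
  have : besselI0 = fun z => (2 * π)⁻¹ * ∫ φ in (-π)..π, Real.exp (z * Real.sin φ) := by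
    ext z; rw [bessel_exp]; field_simp
  rw [this]
  refine continuous_const.mul ?_
  exact intervalIntegral.continuous_parametric_intervalIntegral_of_continuous' (by fun_prop) _ _

lemma bessel_nonneg (z : ℝ) : 0 ≤ besselI0 z := by
  refine tsum_nonneg fun k => ?_
  rw [pow_mul]; positivity

lemma pdf_cont (ν : ℝ) : Continuous (ncChi2Pdf ν) := by
  unfold ncChi2Pdf
  have := bessel_cont
  fun_prop

lemma pdf_nonneg (ν t : ℝ) : 0 ≤ ncChi2Pdf ν t := by
  unfold ncChi2Pdf
  have := bessel_nonneg (Real.sqrt (ν * t))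
  positivity

lemma gauss_anti (c : ℝ) (hc : 0 ≤ c) (a a' : ℝ) (ha : 0 ≤ a) (haa : a ≤ a') :
    gaussianReal a' 1 (Icc (-c) c) ≤ gaussianReal a 1 (Icc (-c) c) := by
  set p := gaussianPDFReal 0 1 with hp
  have hpc : Continuous p := by
    rw [hp, gaussianPDFReal_def]; fun_prop
  have hrep : ∀ a, gaussianReal a 1 (Icc (-c) c)
      = ENNReal.ofReal ((∫ x in (0:ℝ)..(c - a), p x) - ∫ x in (0:ℝ)..(-c - a), p x) := by
    intro a
    have h1 : gaussianReal a 1 = (gaussianReal 0 1).map (· + a) := by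
      rw [gaussianReal_map_add_const, zero_add]
    rw [h1, Measure.map_apply (by fun_prop) measurableSet_Icc]
    have : (fun x => x + a) ⁻¹' Icc (-c) c = Icc (-c - a) (c - a) := by
      ext x; simp
    rw [this, gaussianReal_apply_eq_integral _ one_ne_zero, integral_Icc_eq_integral_Ioc,
      ← intervalIntegral.integral_of_le (by linarith),
      intervalIntegral.integral_interval_sub_left (hpc.intervalIntegrable _ _) (hpc.intervalIntegrable _ _)]
  rw [hrep, hrep]
  apply ENNReal.ofReal_le_ofReal
  have hd : ∀ a, HasDerivAt (fun a => (∫ x in (0:ℝ)..(c - a), p x) - ∫ x in (0:ℝ)..(-c - a), p x)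
      (p (c - a) * (-1) - p (-c - a) * (-1)) a := by
    intro a
    have g : ∀ u, HasDerivAt (fun u => ∫ x in (0:ℝ)..u, p x) (p u) u := fun u =>
      intervalIntegral.integral_hasDerivAt_right (hpc.intervalIntegrable _ _)
        (hpc.stronglyMeasurableAtFilter _ _) hpc.continuousAt
    have e : ∀ k : ℝ, HasDerivAt (fun a => k - a) (-1) a := fun k => by
      simpa using (hasDerivAt_id a).const_sub k
    exact ((g (c - a)).comp a (e c)).sub ((g (-c - a)).comp a (e (-c)))
  have hanti := antitoneOn_of_deriv_nonpos (D := Ici (0:ℝ)) (convex_Ici 0)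
    (fun x _ => (hd x).continuousAt.continuousWithinAt)
    (fun x _ => (hd x).differentiableAt.differentiableWithinAt)
    (fun x hx => by
      rw [interior_Ici, mem_Ioi] at hx
      rw [(hd x).deriv]
      have : p (-c - x) ≤ p (c - x) := by
        simp only [hp, gaussianPDFReal_def]
        refine mul_le_mul_of_nonneg_left (Real.exp_le_exp.mpr ?_) (by positivity)
        push_cast
        have hcx : 0 ≤ c * x := mul_nonneg hc hx.le
        linarith [show -(-c - x - 0) ^ 2 / (2 * 1) - -(c - x - 0) ^ 2 / (2 * 1) = -(2 * (c * x)) by ring]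
      linarith)
  exact hanti ha (ha.trans haa) haa

lemma ball_meas (x : ℝ) : MeasurableSet {p : ℝ × ℝ | p.1 ^ 2 + p.2 ^ 2 ≤ x} :=
  measurableSet_le (by fun_prop) (by fun_prop)

lemma prod_anti (x : ℝ) (a a' : ℝ) (ha : 0 ≤ a) (haa : a ≤ a') :
    ((gaussianReal a' 1).prod (gaussianReal 0 1)) {p : ℝ × ℝ | p.1 ^ 2 + p.2 ^ 2 ≤ x}
      ≤ ((gaussianReal a 1).prod (gaussianReal 0 1)) {p : ℝ × ℝ | p.1 ^ 2 + p.2 ^ 2 ≤ x} := by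
  rw [Measure.prod_apply_symm (ball_meas x), Measure.prod_apply_symm (ball_meas x)]
  refine lintegral_mono fun y => ?_
  by_cases hy : y ^ 2 ≤ x
  · have : (fun u : ℝ => (u, y)) ⁻¹' {p : ℝ × ℝ | p.1 ^ 2 + p.2 ^ 2 ≤ x}
        = Icc (-Real.sqrt (x - y ^ 2)) (Real.sqrt (x - y ^ 2)) := by
      ext u
      simp only [mem_preimage, mem_ofPred_eq, mem_Icc]
      rw [← abs_le, ← Real.sqrt_sq_eq_abs, Real.sqrt_le_sqrt_iff (by linarith)]
      constructor <;> intro h <;> linarith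
    simp only [this]
    exact gauss_anti _ (Real.sqrt_nonneg _) a a' ha haa
  · have : (fun u : ℝ => (u, y)) ⁻¹' {p : ℝ × ℝ | p.1 ^ 2 + p.2 ^ 2 ≤ x} = ∅ := by
      ext u
      simp only [mem_preimage, mem_ofPred_eq, mem_empty_iff_false, iff_false]
      nlinarith [sq_nonneg u]
    simp [this]

noncomputable def polG (a b : ℝ) (p : ℝ × ℝ) : ℝ :=
  p.1 * ((2 * π)⁻¹ * Real.exp (-(p.1 ^ 2 + (a ^ 2 + b ^ 2)) / 2)) *
    Real.exp (p.1 * (a * Real.cos p.2 + b * Real.sin p.2))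

lemma pdf_prod (a b u v : ℝ) : gaussianPDF a 1 u * gaussianPDF b 1 v
    = ENNReal.ofReal ((2 * π)⁻¹ * Real.exp (-((u - a) ^ 2 + (v - b) ^ 2) / 2)) := by
  rw [gaussianPDF, gaussianPDF, ← ENNReal.ofReal_mul (gaussianPDFReal_nonneg _ _ _)]
  congr 1
  simp only [gaussianPDFReal_def, NNReal.coe_one, mul_one]
  have h : (Real.sqrt (2 * π))⁻¹ * (Real.sqrt (2 * π))⁻¹ = (2 * π)⁻¹ := by
    rw [← mul_inv, Real.mul_self_sqrt (by positivity)]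
  rw [mul_mul_mul_comm, h, ← Real.exp_add]
  congr 2
  ring

lemma polG_integrable (a b x : ℝ) :
    IntegrableOn (polG a b) (Ioc 0 (Real.sqrt x) ×ˢ Ioo (-π) π) := by
  have hc : Continuous (polG a b) := by unfold polG; fun_prop
  exact (hc.continuousOn.integrableOn_compact (isCompact_Icc.prod isCompact_Icc)).mono_set
    (prod_mono Ioc_subset_Icc_self Ioo_subset_Icc_self)

lemma polG_integral (a b x : ℝ) (hx : 0 ≤ x) :
    (∫ p in Ioc 0 (Real.sqrt x) ×ˢ Ioo (-π) π, polG a b p) = Gamma2 x (a ^ 2 + b ^ 2) := by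
  have hint := polG_integrable a b x
  rw [Measure.volume_eq_prod] at hint ⊢
  rw [setIntegral_prod _ hint, ← intervalIntegral.integral_of_le (Real.sqrt_nonneg x)]
  have inner : ∀ r ∈ uIcc 0 (Real.sqrt x), (∫ φ in Ioo (-π) π, polG a b (r, φ))
      = (ncChi2Pdf (a ^ 2 + b ^ 2) ∘ fun r => r ^ 2) r * (2 * r) := by
    intro r hr
    rw [uIcc_of_le (Real.sqrt_nonneg x)] at hr
    rw [← integral_Ioc_eq_integral_Ioo, ← intervalIntegral.integral_of_le (by linarith [Real.pi_pos])]
    simp only [polG]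
    rw [intervalIntegral.integral_const_mul, bessel_ab]
    simp only [Function.comp, ncChi2Pdf]
    rw [Real.sqrt_mul (by positivity), Real.sqrt_sq hr.1, mul_comm r (Real.sqrt _)]
    field_simp
  rw [intervalIntegral.integral_congr inner,
    intervalIntegral.integral_comp_mul_deriv (f := fun r => r ^ 2) (f' := fun r => 2 * r)
      (fun r _ => by simpa using hasDerivAt_pow 2 r) (by fun_prop) (pdf_cont _)]
  simp only [Gamma2, Real.sq_sqrt hx]
  norm_num

lemma ball_law (a b x : ℝ) (hx : 0 ≤ x) :
    ((gaussianReal a 1).prod (gaussianReal b 1)) {p : ℝ × ℝ | p.1 ^ 2 + p.2 ^ 2 ≤ x}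
      = ENNReal.ofReal (Gamma2 x (a ^ 2 + b ^ 2)) := by
  rw [gaussianReal_of_var_ne_zero _ one_ne_zero, gaussianReal_of_var_ne_zero _ one_ne_zero,
    prod_withDensity (measurable_gaussianPDF _ _) (measurable_gaussianPDF _ _),
    withDensity_apply _ (ball_meas x), ← lintegral_indicator (ball_meas x),
    ← Measure.volume_eq_prod, ← lintegral_comp_polarCoord_symm, ← polG_integral a b x hx,
    ofReal_integral_eq_lintegral_ofReal (polG_integrable a b x)]
  · have hm : MeasurableSet (Ioc 0 (Real.sqrt x) ×ˢ Ioo (-π) π) :=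
      measurableSet_Ioc.prod measurableSet_Ioo
    have ht : MeasurableSet polarCoord.target := polarCoord.open_target.measurableSet
    rw [← lintegral_indicator ht, ← lintegral_indicator hm]
    congr 1
    ext ⟨r, φ⟩
    by_cases hr : (r, φ) ∈ polarCoord.target
    · rw [indicator_of_mem hr]
      have hr' : 0 < r ∧ φ ∈ Ioo (-π) π := by simpa [polarCoord] using hr
      have hball : polarCoord.symm (r, φ) ∈ {p : ℝ × ℝ | p.1 ^ 2 + p.2 ^ 2 ≤ x} ↔ r ≤ Real.sqrt x := by
        rw [Real.le_sqrt hr'.1.le hx, polarCoord_symm_apply, mem_ofPred_eq]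
        have : (r * Real.cos φ) ^ 2 + (r * Real.sin φ) ^ 2 = r ^ 2 := by
          linear_combination r ^ 2 * Real.cos_sq_add_sin_sq φ
        simp only [this]
      by_cases hb : r ≤ Real.sqrt x
      · rw [indicator_of_mem (hball.2 hb), indicator_of_mem (show (r, φ) ∈ Ioc 0 (Real.sqrt x) ×ˢ Ioo (-π) π from ⟨⟨hr'.1, hb⟩, hr'.2⟩)]
        rw [pdf_prod, smul_eq_mul, ← ENNReal.ofReal_mul hr'.1.le]
        congr 1
        simp only [polG, polarCoord_symm_apply]
        rw [mul_assoc, mul_assoc, ← Real.exp_add]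
        congr 3
        linear_combination (-r ^ 2 / 2) * Real.cos_sq_add_sin_sq φ
      · rw [indicator_of_notMem (fun h => hb (hball.1 h)), indicator_of_notMem (fun h => hb h.1.2), smul_zero]
    · rw [indicator_of_notMem hr, indicator_of_notMem]
      intro h
      exact hr (by simpa [polarCoord] using ⟨h.1.1, h.2⟩)
  · refine (ae_restrict_iff' (measurableSet_Ioc.prod measurableSet_Ioo)).2 (ae_of_all _ fun p hp => ?_)
    have := hp.1.1
    simp only [polG, Pi.zero_apply]
    positivity

lemma Gamma2_anti (x a a' : ℝ) (hx : 0 ≤ x) (ha : 0 ≤ a) (haa : a ≤ a') :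
    ENNReal.ofReal (Gamma2 x (a' ^ 2)) ≤ ENNReal.ofReal (Gamma2 x (a ^ 2)) := by
  have h := prod_anti x a a' ha haa
  rw [ball_law _ _ _ hx, ball_law _ _ _ hx] at h
  simpa using h

lemma Gamma2_cont (ν : ℝ) : Continuous fun x => Gamma2 x ν :=
  intervalIntegral.continuous_primitive (fun _ _ => (pdf_cont ν).intervalIntegrable _ _) 0

lemma Gamma2_mono (ν : ℝ) : Monotone fun x => Gamma2 x ν := by
  intro x y hxy
  have h := intervalIntegral.integral_interval_sub_left (a := 0) (b := y) (c := x)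
    ((pdf_cont ν).intervalIntegrable (μ := volume) _ _) ((pdf_cont ν).intervalIntegrable _ _)
  have h2 : 0 ≤ ∫ t in x..y, ncChi2Pdf ν t :=
    intervalIntegral.integral_nonneg hxy fun t _ => pdf_nonneg ν t
  simp only [Gamma2]
  linarith

lemma scaled_law {Ω : Type*} [MeasureSpace Ω] [IsProbabilityMeasure (ℙ : Measure Ω)]
    (θ σ : ℝ) (hσ : 0 < σ) (Y : Ω → ℝ) (v : NNReal) (hv : v = NNReal.mk (σ ^ 2) (sq_nonneg σ))
    (h : Measure.map Y ℙ = gaussianReal θ v) :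
    AEMeasurable Y ℙ ∧ Measure.map (fun ω => Y ω / σ) ℙ = gaussianReal (θ / σ) 1 := by
  have hY : AEMeasurable Y ℙ := by
    by_contra hn
    rw [Measure.map_of_not_aemeasurable hn] at h
    exact (IsProbabilityMeasure.ne_zero (gaussianReal θ v)) h.symm
  refine ⟨hY, ?_⟩
  have : (fun ω => Y ω / σ) = (fun y => y / σ) ∘ Y := rfl
  rw [this, ← AEMeasurable.map_map_of_aemeasurable (by fun_prop) hY, h, gaussianReal_map_div_const,
    ← hv]
  congr 1
  apply div_self
  intro h0
  have h1 : σ ^ 2 = 0 := by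
    rw [hv] at h0
    exact congrArg NNReal.toReal h0
  exact (pow_pos hσ 2).ne' h1

theorem stmt_11 {Ω : Type*} [MeasureSpace Ω] [IsProbabilityMeasure (ℙ : Measure Ω)]
    (θ₁ θ₂ σ R : ℝ) (hσ : 0 < σ) (hR : 0 < R)
    (hθ : Real.sqrt (θ₁ ^ 2 + θ₂ ^ 2) < R)
    (Y₁ Y₂ : Ω → ℝ)
    (h₁ : Measure.map Y₁ ℙ = gaussianReal θ₁ ⟨σ ^ 2, sq_nonneg σ⟩)
    (h₂ : Measure.map Y₂ ℙ = gaussianReal θ₂ ⟨σ ^ 2, sq_nonneg σ⟩)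
    (hind : IndepFun Y₁ Y₂ ℙ) :
    ∀ α ∈ Set.Ioo (0:ℝ) 1,
      ℙ {ω | 1 - α <
          1 - (1 - Gamma2 ((Y₁ ω ^ 2 + Y₂ ω ^ 2) / σ ^ 2) (R ^ 2 / σ ^ 2))}
        ≤ ENNReal.ofReal α := by
  intro α hα
  set ν := R ^ 2 / σ ^ 2 with hν
  by_cases hex : ∃ x, 0 ≤ x ∧ 1 - α < Gamma2 x ν
  swap
  · push Not at hex
    have : {ω | 1 - α < 1 - (1 - Gamma2 ((Y₁ ω ^ 2 + Y₂ ω ^ 2) / σ ^ 2) ν)} = ∅ := by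
      ext ω
      simp only [mem_ofPred_eq, mem_empty_iff_false, iff_false, not_lt]
      have := hex ((Y₁ ω ^ 2 + Y₂ ω ^ 2) / σ ^ 2) (by positivity)
      linarith
    rw [this]; simp
  obtain ⟨x, hx0, hx⟩ := hex
  obtain ⟨q, hq, hqe⟩ : 1 - α ∈ (fun x => Gamma2 x ν) '' Icc 0 x := by
    refine intermediate_value_Icc hx0 (Gamma2_cont ν).continuousOn ⟨?_, hx.le⟩
    simp only [Gamma2, intervalIntegral.integral_same]
    linarith [hα.2]
  simp only at hqe
  obtain ⟨m₁, l₁⟩ := scaled_law θ₁ σ hσ Y₁ _ rfl h₁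
  obtain ⟨m₂, l₂⟩ := scaled_law θ₂ σ hσ Y₂ _ rfl h₂
  have hind' : IndepFun (fun ω => Y₁ ω / σ) (fun ω => Y₂ ω / σ) ℙ :=
    hind.comp (φ := fun y => y / σ) (ψ := fun y => y / σ) (by fun_prop) (by fun_prop)
  have n₁ : AEMeasurable (fun ω => Y₁ ω / σ) ℙ := m₁.div_const σ
  have n₂ : AEMeasurable (fun ω => Y₂ ω / σ) ℙ := m₂.div_const σ
  have hlaw := (indepFun_iff_map_prod_eq_prod_map_map n₁ n₂).1 hind'
  rw [l₁, l₂] at hlaw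
  set B := {p : ℝ × ℝ | p.1 ^ 2 + p.2 ^ 2 ≤ q} with hB
  have hsub : {ω | 1 - α < 1 - (1 - Gamma2 ((Y₁ ω ^ 2 + Y₂ ω ^ 2) / σ ^ 2) ν)}
      ⊆ (fun ω => (Y₁ ω / σ, Y₂ ω / σ)) ⁻¹' Bᶜ := by
    intro ω hω
    simp only [mem_ofPred_eq, sub_sub_cancel] at hω
    simp only [hB, mem_preimage, mem_compl_iff, mem_ofPred_eq, not_le]
    by_contra hle
    rw [not_lt, div_pow, div_pow, ← add_div] at hle
    have := Gamma2_mono ν hle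
    simp only at this
    linarith
  refine (measure_mono hsub).trans ?_
  rw [← Measure.map_apply_of_aemeasurable (n₁.prodMk n₂) (ball_meas q).compl, hlaw,
    prob_compl_eq_one_sub (ball_meas q), ball_law _ _ _ hq.1]
  have hmono := Gamma2_anti q (Real.sqrt (θ₁ ^ 2 + θ₂ ^ 2) / σ) (R / σ) hq.1 (by positivity)
    (by gcongr)
  rw [div_pow, div_pow, Real.sq_sqrt (by positivity), ← hν, hqe, add_div, ← div_pow, ← div_pow] at hmono
  refine (tsub_le_tsub_left hmono 1).trans ?_
  rw [← ENNReal.ofReal_one, ← ENNReal.ofReal_sub _ (by linarith [hα.2])]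
  simp
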